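/- With 𝒜, Ā, and 𝒜^c = Ā − 𝒜 as defined, let U = [[𝒜^c, 𝒜],[𝒜, 𝒜^c]], U₁ = [[I − 𝒜𝒜ᵀ, 𝒜𝒜ᵀ],[𝒜𝒜ᵀ, I − 𝒜𝒜ᵀ]], and U₂ = [[Ā, 0],[0, Ā]]. Then U = U₁·U₂, and both U₁ and U₂ are unitary matrices. -/

import Mathlib

noncomputable section
open Matrix BigOperators Finset

/-- Kronecker product of complex matrices, with the big-endian index identification
`i = p·i₁ + i₂` (first factor is the high-order register). -/
def kron {m n p q : ℕ} (A : Matrix (Fin m) (Fin n) ℂ) (B : Matrix (Fin p) (Fin q) ℂ) :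
    Matrix (Fin (m * p)) (Fin (n * q)) ℂ :=
  Matrix.of fun i j => A i.divNat j.divNat * B i.modNat j.modNat

/-- `l`-fold Kronecker power `B^{⊗l}`. -/
def kronPow {n : ℕ} (B : Matrix (Fin n) (Fin n) ℂ) : (l : ℕ) → Matrix (Fin (n ^ l)) (Fin (n ^ l)) ℂ
  | 0 => 1
  | l + 1 => kron (kronPow B l) B

/-- Recast a matrix along equalities of its dimensions. -/
def mcast {a b c d : ℕ} (h1 : a = b) (h2 : c = d) (M : Matrix (Fin a) (Fin c) ℂ) :
    Matrix (Fin b) (Fin d) ℂ :=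
  M.submatrix (Fin.cast h1.symm) (Fin.cast h2.symm)

/-- The commutation matrix `K^{(a,b)}`, the `ab × ab` permutation matrix determined by
`K (x ⊗ y) = y ⊗ x`: column `b·x + y` has its unique `1` in row `a·y + x`. -/
def commMat (a b : ℕ) : Matrix (Fin (a * b)) (Fin (a * b)) ℂ :=
  Matrix.of fun i j => if (i : ℕ) = a * ((j : ℕ) % b) + (j : ℕ) / b then 1 else 0

/-- τ0, τ1, τ2, τ3. -/
def τ : Fin 4 → Matrix (Fin 2) (Fin 2) ℂ
  | 0 => !![1, 0; 0, 0]
  | 1 => !![0, 1; 0, 0]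
  | 2 => !![0, 0; 1, 0]
  | 3 => !![0, 0; 0, 1]

/-- ρ0 = τ0, ρ1 = τ1, ρ2 = τ2, ρ3 = τ3, ρ4 = I₂. -/
def ρ : Fin 5 → Matrix (Fin 2) (Fin 2) ℂ
  | 0 => !![1, 0; 0, 0]
  | 1 => !![0, 1; 0, 0]
  | 2 => !![0, 0; 1, 0]
  | 3 => !![0, 0; 0, 1]
  | 4 => 1

def σx : Matrix (Fin 2) (Fin 2) ℂ := !![0, 1; 1, 0]

/-- ρ̄ = σx for ρ1, ρ2 and ρ̄ = I₂ for ρ0, ρ3, ρ4. -/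
def ρbar : Fin 5 → Matrix (Fin 2) (Fin 2) ℂ
  | 0 => 1
  | 1 => σx
  | 2 => σx
  | 3 => 1
  | 4 => 1

/-- The Kronecker product `f 0 ⊗ f 1 ⊗ ⋯ ⊗ f (Q−1)` of 2×2 matrices (leftmost factor
is the most significant register). -/
def kronSeq : (Q : ℕ) → (Fin Q → Matrix (Fin 2) (Fin 2) ℂ) → Matrix (Fin (2 ^ Q)) (Fin (2 ^ Q)) ℂ
  | 0, _ => 1
  | Q + 1, f => kron (kronSeq Q fun k => f k.castSucc) (f (Fin.last Q))

/-- A (real) permutation matrix: a 0/1 matrix with exactly one 1 in each row and column. -/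
def IsPermMatrix {N : ℕ} (M : Matrix (Fin N) (Fin N) ℂ) : Prop :=
  (∀ i j, M i j = 0 ∨ M i j = 1) ∧ (∀ i, ∃! j, M i j = 1) ∧ (∀ j, ∃! i, M i j = 1)

/-- 𝒟 = τ0^{⊗s} ⊗ I_{n_x}, where n_x = 2^s. -/
def Dmat (s : ℕ) : Matrix (Fin ((2 ^ s) ^ 2)) (Fin ((2 ^ s) ^ 2)) ℂ :=
  mcast (by ring) (by ring) (kron (kronPow (τ 0) s) (1 : Matrix (Fin (2 ^ s)) (Fin (2 ^ s)) ℂ))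

/-- The middle factor (τ0^{⊗s} ⊗ K^{(n_x^l,n_x)}) · (𝒟P ⊗ I_{n_x}^{⊗l}) · K^{(n_x²,n_x^l)}
of 𝒜. -/
def midA (s l : ℕ) (P : Matrix (Fin ((2 ^ s) ^ 2)) (Fin ((2 ^ s) ^ 2)) ℂ) :
    Matrix (Fin ((2 ^ s) ^ (l + 2))) (Fin ((2 ^ s) ^ (l + 2))) ℂ :=
  mcast (by ring) (by ring) (kron (kronPow (τ 0) s) (commMat ((2 ^ s) ^ l) (2 ^ s))) *
    mcast (by ring) (by ring)
      (kron (Dmat s * P) (1 : Matrix (Fin ((2 ^ s) ^ l)) (Fin ((2 ^ s) ^ l)) ℂ)) *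
    mcast (by ring) (by ring) (commMat ((2 ^ s) ^ 2) ((2 ^ s) ^ l))

/-- The middle factor (I_{n_x} ⊗ K^{(n_x^l,n_x)}) · (P ⊗ I_{n_x}^{⊗l}) · K^{(n_x²,n_x^l)}
of Ā. -/
def midAbar (s l : ℕ) (P : Matrix (Fin ((2 ^ s) ^ 2)) (Fin ((2 ^ s) ^ 2)) ℂ) :
    Matrix (Fin ((2 ^ s) ^ (l + 2))) (Fin ((2 ^ s) ^ (l + 2))) ℂ :=
  mcast (by ring) (by ring)
      (kron (1 : Matrix (Fin (2 ^ s)) (Fin (2 ^ s)) ℂ) (commMat ((2 ^ s) ^ l) (2 ^ s))) *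
    mcast (by ring) (by ring) (kron P (1 : Matrix (Fin ((2 ^ s) ^ l)) (Fin ((2 ^ s) ^ l)) ℂ)) *
    mcast (by ring) (by ring) (commMat ((2 ^ s) ^ 2) ((2 ^ s) ^ l))

/-- 𝒜 = (ρ_{r_0} ⊗ ⋯ ⊗ ρ_{r_{Q1−1}}) ⊗
  [(τ0^{⊗s} ⊗ K^{(n_x^l,n_x)}) · (𝒟P ⊗ I_{n_x}^{⊗l}) · K^{(n_x²,n_x^l)}] ⊗ I_{n_x}^{⊗(j−l−1)}. -/
def Afull (s Q1 l j : ℕ) (r : Fin Q1 → Fin 5)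
    (P : Matrix (Fin ((2 ^ s) ^ 2)) (Fin ((2 ^ s) ^ 2)) ℂ) :
    Matrix (Fin (2 ^ Q1 * ((2 ^ s) ^ (l + 2) * (2 ^ s) ^ (j - l - 1))))
      (Fin (2 ^ Q1 * ((2 ^ s) ^ (l + 2) * (2 ^ s) ^ (j - l - 1)))) ℂ :=
  kron (kronSeq Q1 fun k => ρ (r k))
    (kron (midA s l P) (kronPow (1 : Matrix (Fin (2 ^ s)) (Fin (2 ^ s)) ℂ) (j - l - 1)))

/-- Ā = (ρ̄_{r_0} ⊗ ⋯ ⊗ ρ̄_{r_{Q1−1}}) ⊗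
  [(I_{n_x} ⊗ K^{(n_x^l,n_x)}) · (P ⊗ I_{n_x}^{⊗l}) · K^{(n_x²,n_x^l)}] ⊗ I_{n_x}^{⊗(j−l−1)}. -/
def Abarfull (s Q1 l j : ℕ) (r : Fin Q1 → Fin 5)
    (P : Matrix (Fin ((2 ^ s) ^ 2)) (Fin ((2 ^ s) ^ 2)) ℂ) :
    Matrix (Fin (2 ^ Q1 * ((2 ^ s) ^ (l + 2) * (2 ^ s) ^ (j - l - 1))))
      (Fin (2 ^ Q1 * ((2 ^ s) ^ (l + 2) * (2 ^ s) ^ (j - l - 1)))) ℂ :=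
  kron (kronSeq Q1 fun k => ρbar (r k))
    (kron (midAbar s l P) (kronPow (1 : Matrix (Fin (2 ^ s)) (Fin (2 ^ s)) ℂ) (j - l - 1)))

/-- A real orthogonal matrix, regarded as a complex matrix. -/
def IsRealOrthogonal {n : Type*} [Fintype n] [DecidableEq n] (B : Matrix n n ℂ) : Prop :=
  Bᴴ = Bᵀ ∧ B * Bᵀ = 1

/-- The matrix of a real orthogonal projection, regarded as a complex matrix. -/
def IsRealProjection {n : Type*} [Fintype n] (E : Matrix n n ℂ) : Prop :=
  Eᴴ = E ∧ Eᵀ = E ∧ E * E = E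

/-- `A` is obtained from the real orthogonal matrix `B` by projecting its range. -/
def IsProjectionOf {n : Type*} [Fintype n] [DecidableEq n] (A B : Matrix n n ℂ) : Prop :=
  IsRealOrthogonal B ∧ ∃ E, IsRealProjection E ∧ A = E * B

section Kron

lemma kron_eq_submatrix {m n p q : ℕ} (A : Matrix (Fin m) (Fin n) ℂ)
    (B : Matrix (Fin p) (Fin q) ℂ) :
    kron A B = (kroneckerMap (· * ·) A B).submatrix finProdFinEquiv.symm finProdFinEquiv.symm :=
  rfl

lemma kron_mul_kron {m n k p q t : ℕ} (A : Matrix (Fin m) (Fin n) ℂ) (A' : Matrix (Fin n) (Fin k) ℂ)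
    (B : Matrix (Fin p) (Fin q) ℂ) (B' : Matrix (Fin q) (Fin t) ℂ) :
    kron A B * kron A' B' = kron (A * A') (B * B') := by
  simp only [kron_eq_submatrix, submatrix_mul_equiv]
  rw [← mul_kronecker_mul]

lemma transpose_kron {m n p q : ℕ} (A : Matrix (Fin m) (Fin n) ℂ) (B : Matrix (Fin p) (Fin q) ℂ) :
    (kron A B)ᵀ = kron Aᵀ Bᵀ :=
  rfl

lemma conjTranspose_kron {m n p q : ℕ} (A : Matrix (Fin m) (Fin n) ℂ)
    (B : Matrix (Fin p) (Fin q) ℂ) :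
    (kron A B)ᴴ = kron Aᴴ Bᴴ := by
  ext i j
  simp [kron]

lemma kron_one_one (m p : ℕ) :
    kron (1 : Matrix (Fin m) (Fin m) ℂ) (1 : Matrix (Fin p) (Fin p) ℂ) = 1 := by
  simp only [kron_eq_submatrix]
  rw [one_kronecker_one, submatrix_one_equiv]

lemma kronPow_one (n l : ℕ) : kronPow (1 : Matrix (Fin n) (Fin n) ℂ) l = 1 := by
  induction l with
  | zero => rfl
  | succ l ih => rw [kronPow, ih, kron_one_one]; rfl

lemma mcast_mul {a b : ℕ} (h₁ h₂ h₃ h₄ : a = b) (M N : Matrix (Fin a) (Fin a) ℂ) :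
    mcast h₁ h₂ M * mcast h₃ h₄ N = mcast h₁ h₂ (M * N) := by
  subst h₁
  rfl

lemma mcast_mcast {a b c : ℕ} (h₁ h₂ : a = b) (h₃ h₄ : b = c) (M : Matrix (Fin a) (Fin a) ℂ) :
    mcast h₃ h₄ (mcast h₁ h₂ M) = mcast (h₁.trans h₃) (h₂.trans h₄) M :=
  rfl

lemma kron_mcast_kron_one_one {m p q c N : ℕ} (hc : c = p * q) (h₁ h₂ : m * p = N)
    (h : m * c = N * q) (T : Matrix (Fin m) (Fin m) ℂ) :
    kron (mcast h₁ h₂ (kron T (1 : Matrix (Fin p) (Fin p) ℂ))) (1 : Matrix (Fin q) (Fin q) ℂ) =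
      mcast h h (kron T (1 : Matrix (Fin c) (Fin c) ℂ)) := by
  subst hc h₁
  rw [← kron_one_one]
  ext i j
  have hdiv (x : Fin (m * p * q)) :
      (Fin.cast h.symm x).divNat = x.divNat.divNat := by
    ext; simp [Nat.div_div_eq_div_mul, mul_comm]
  have hmd (x : Fin (m * p * q)) :
      (Fin.cast h.symm x).modNat.divNat = x.divNat.modNat := by
    ext; simp [Nat.mod_mul_left_div_self]
  have hmm (x : Fin (m * p * q)) :
      (Fin.cast h.symm x).modNat.modNat = x.modNat := by
    ext; simp
  simp only [kron, mcast, of_apply, submatrix_apply, hdiv]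
  rw [hmd, hmd, hmm, hmm, ← mul_assoc]
  rfl

end Kron

namespace IsRealOrthogonal

lemma one {n : Type*} [Fintype n] [DecidableEq n] : IsRealOrthogonal (1 : Matrix n n ℂ) := by
  simp [IsRealOrthogonal]

lemma mul {n : Type*} [Fintype n] [DecidableEq n] {A B : Matrix n n ℂ}
    (hA : IsRealOrthogonal A) (hB : IsRealOrthogonal B) : IsRealOrthogonal (A * B) := by
  refine ⟨by rw [conjTranspose_mul, transpose_mul, hA.1, hB.1], ?_⟩
  rw [transpose_mul, mul_assoc, ← mul_assoc B, hB.2, one_mul, hA.2]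

lemma kron {m p : ℕ} {A : Matrix (Fin m) (Fin m) ℂ} {B : Matrix (Fin p) (Fin p) ℂ}
    (hA : IsRealOrthogonal A) (hB : IsRealOrthogonal B) : IsRealOrthogonal (kron A B) := by
  refine ⟨by rw [conjTranspose_kron, transpose_kron, hA.1, hB.1], ?_⟩
  rw [transpose_kron, kron_mul_kron, hA.2, hB.2, kron_one_one]

lemma mcast {a b : ℕ} (h₁ h₂ : a = b) {M : Matrix (Fin a) (Fin a) ℂ} (hM : IsRealOrthogonal M) :
    IsRealOrthogonal (mcast h₁ h₂ M) := by
  subst h₁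
  exact hM

lemma mul_conjTranspose {n : Type*} [Fintype n] [DecidableEq n] {B : Matrix n n ℂ}
    (hB : IsRealOrthogonal B) : B * Bᴴ = 1 := by
  rw [hB.1, hB.2]

end IsRealOrthogonal

lemma isRealOrthogonal_σx : IsRealOrthogonal σx := by
  constructor <;> ext i j <;> fin_cases i <;> fin_cases j <;> simp [σx, mul_apply]

lemma isRealOrthogonal_commMat (a b : ℕ) : IsRealOrthogonal (commMat a b) := by
  let e : Fin (a * b) ≃ Fin (a * b) :=
    finProdFinEquiv.symm.trans ((Equiv.prodComm _ _).trans
      (finProdFinEquiv.trans (finCongr (mul_comm b a))))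
  have h : commMat a b = (1 : Matrix _ _ ℂ).submatrix (Equiv.refl _) e := by
    ext i j
    simp [commMat, e, one_apply, Fin.ext_iff, add_comm]
  rw [h]
  constructor
  · rw [conjTranspose_submatrix, transpose_submatrix, conjTranspose_one, transpose_one]
  · rw [transpose_submatrix, submatrix_mul_equiv, transpose_one, one_mul, submatrix_one_equiv]

lemma IsPermMatrix.isRealOrthogonal {N : ℕ} {M : Matrix (Fin N) (Fin N) ℂ} (hM : IsPermMatrix M) :
    IsRealOrthogonal M := by
  obtain ⟨h01, hrow, hcol⟩ := hM
  constructor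
  · ext i j
    rcases h01 j i with h | h <;> simp [h]
  · ext i k
    obtain ⟨c, hc, hcu⟩ := hrow i
    rw [mul_apply, Finset.sum_eq_single c]
    · by_cases hik : i = k
      · subst hik
        simp [hc]
      · have : M k c = 0 := (h01 k c).resolve_right fun h => hik ((hcol c).unique hc h)
        simp [this, hik]
    · intro b _ hb
      simp [(h01 i b).resolve_right fun h => hb (hcu b h)]
    · simp

namespace IsRealProjection

lemma one {n : Type*} [Fintype n] [DecidableEq n] : IsRealProjection (1 : Matrix n n ℂ) := by
  simp [IsRealProjection]

lemma kron {m p : ℕ} {A : Matrix (Fin m) (Fin m) ℂ} {B : Matrix (Fin p) (Fin p) ℂ}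
    (hA : IsRealProjection A) (hB : IsRealProjection B) : IsRealProjection (kron A B) := by
  refine ⟨by rw [conjTranspose_kron, hA.1, hB.1], by rw [transpose_kron, hA.2.1, hB.2.1], ?_⟩
  rw [kron_mul_kron, hA.2.2, hB.2.2]

lemma kronPow {n : ℕ} {A : Matrix (Fin n) (Fin n) ℂ} (hA : IsRealProjection A) (l : ℕ) :
    IsRealProjection (kronPow A l) := by
  induction l with
  | zero => exact one
  | succ l ih => exact ih.kron hA

lemma mcast {a b : ℕ} (h₁ h₂ : a = b) {M : Matrix (Fin a) (Fin a) ℂ} (hM : IsRealProjection M) :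
    IsRealProjection (mcast h₁ h₂ M) := by
  subst h₁
  exact hM

end IsRealProjection

lemma isRealProjection_τ_zero : IsRealProjection (τ 0) := by
  refine ⟨?_, ?_, ?_⟩ <;> ext i j <;> fin_cases i <;> fin_cases j <;> simp [τ]

lemma isRealProjection_τ_three : IsRealProjection (τ 3) := by
  refine ⟨?_, ?_, ?_⟩ <;> ext i j <;> fin_cases i <;> fin_cases j <;> simp [τ]

namespace IsProjectionOf

lemma one {n : Type*} [Fintype n] [DecidableEq n] :
    IsProjectionOf (1 : Matrix n n ℂ) (1 : Matrix n n ℂ) :=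
  ⟨.one, 1, .one, (one_mul 1).symm⟩

lemma kron {m p : ℕ} {A B : Matrix (Fin m) (Fin m) ℂ} {A' B' : Matrix (Fin p) (Fin p) ℂ}
    (h : IsProjectionOf A B) (h' : IsProjectionOf A' B') :
    IsProjectionOf (kron A A') (kron B B') := by
  obtain ⟨hB, E, hE, rfl⟩ := h
  obtain ⟨hB', E', hE', rfl⟩ := h'
  exact ⟨hB.kron hB', _, hE.kron hE', (kron_mul_kron ..).symm⟩

lemma ρ_ρbar (k : Fin 5) : IsProjectionOf (ρ k) (ρbar k) := by
  fin_cases k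
  · exact ⟨.one, τ 0, isRealProjection_τ_zero, (mul_one _).symm⟩
  · exact ⟨isRealOrthogonal_σx, τ 0, isRealProjection_τ_zero, by simp [ρ, ρbar, τ, σx]⟩
  · exact ⟨isRealOrthogonal_σx, τ 3, isRealProjection_τ_three, by simp [ρ, ρbar, τ, σx]⟩
  · exact ⟨.one, τ 3, isRealProjection_τ_three, (mul_one _).symm⟩
  · exact .one

lemma kronSeq (Q : ℕ) {f g : Fin Q → Matrix (Fin 2) (Fin 2) ℂ}
    (h : ∀ k, IsProjectionOf (f k) (g k)) : IsProjectionOf (kronSeq Q f) (kronSeq Q g) := by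
  induction Q with
  | zero => exact .one
  | succ Q ih => exact (ih fun k => h k.castSucc).kron (h (Fin.last Q))

lemma midA_midAbar (s l : ℕ) {P : Matrix (Fin ((2 ^ s) ^ 2)) (Fin ((2 ^ s) ^ 2)) ℂ}
    (hP : IsPermMatrix P) : IsProjectionOf (midA s l P) (midAbar s l P) := by
  have h : 2 ^ s * ((2 ^ s) ^ l * 2 ^ s) = (2 ^ s) ^ (l + 2) := by ring
  have h' : (2 ^ s) ^ 2 * (2 ^ s) ^ l = (2 ^ s) ^ (l + 2) := by ring
  have hT := isRealProjection_τ_zero.kronPow s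
  refine ⟨?_, _root_.mcast h h (_root_.kron (_root_.kronPow (τ 0) s) 1),
    (hT.kron .one).mcast h h, ?_⟩
  · exact (((IsRealOrthogonal.one.kron (isRealOrthogonal_commMat _ _)).mcast _ _).mul
      ((hP.isRealOrthogonal.kron .one).mcast _ _)).mul ((isRealOrthogonal_commMat _ _).mcast _ _)
  · have hD : _root_.kron (Dmat s * P) (1 : Matrix (Fin ((2 ^ s) ^ l)) (Fin ((2 ^ s) ^ l)) ℂ) =
        _root_.mcast (h.trans h'.symm) (h.trans h'.symm) (_root_.kron (_root_.kronPow (τ 0) s) 1) *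
          _root_.kron P 1 := by
      rw [← kron_mcast_kron_one_one (mul_comm _ _) (by ring) (by ring), kron_mul_kron, one_mul]
      rfl
    have hY : _root_.mcast h' h' (_root_.kron (Dmat s * P) 1) =
        _root_.mcast h h (_root_.kron (_root_.kronPow (τ 0) s) 1) *
          _root_.mcast h' h' (_root_.kron P 1) := by
      rw [hD, ← mcast_mul h' h' h' h', mcast_mcast]
    simp only [midA, midAbar]
    rw [hY]
    simp only [← mul_assoc]
    congr 2
    simp only [mcast_mul, kron_mul_kron, mul_one, one_mul, hT.2.2]

lemma mul_transpose {n : Type*} [Fintype n] [DecidableEq n] {A B : Matrix n n ℂ}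
    (h : IsProjectionOf A B) : IsRealProjection (A * Aᵀ) ∧ A * Aᵀ * B = A := by
  obtain ⟨hB, E, hE, rfl⟩ := h
  have : E * B * (E * B)ᵀ = E := by
    rw [transpose_mul, mul_assoc, ← mul_assoc B, hB.2, one_mul, hE.2.1, hE.2.2]
  rw [this]
  exact ⟨hE, rfl⟩

lemma Afull_Abarfull (s Q l j : ℕ) (r : Fin Q → Fin 5)
    {P : Matrix (Fin ((2 ^ s) ^ 2)) (Fin ((2 ^ s) ^ 2)) ℂ} (hP : IsPermMatrix P) :
    IsProjectionOf (Afull s Q l j r P) (Abarfull s Q l j r P) := by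
  refine (kronSeq Q fun k => ρ_ρbar (r k)).kron ((midA_midAbar s l hP).kron ?_)
  rw [kronPow_one]
  exact .one

end IsProjectionOf

/-- The controlled reflection attached to a real projection is a Hermitian involution. -/
lemma IsRealProjection.fromBlocks_mul_conjTranspose {n : Type*} [Fintype n] [DecidableEq n]
    {E : Matrix n n ℂ} (hE : IsRealProjection E) :
    fromBlocks (1 - E) E E (1 - E) * (fromBlocks (1 - E) E E (1 - E))ᴴ = 1 := by
  rw [fromBlocks_conjTranspose, conjTranspose_sub, conjTranspose_one, hE.1, fromBlocks_multiply,
    ← fromBlocks_one]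
  congr 1 <;> simp [mul_sub, sub_mul, hE.2.2]

/-- With 𝒜, Ā, and 𝒜^c = Ā − 𝒜 as defined, let
U = [[𝒜^c, 𝒜],[𝒜, 𝒜^c]], U₁ = [[I − 𝒜𝒜ᵀ, 𝒜𝒜ᵀ],[𝒜𝒜ᵀ, I − 𝒜𝒜ᵀ]] and U₂ = [[Ā, 0],[0, Ā]].
Then U = U₁·U₂, and both U₁ and U₂ are unitary. -/
theorem statement2 (s Q1 l j : ℕ) (hs : 1 ≤ s) (hjl : l + 1 ≤ j) (r : Fin Q1 → Fin 5)
    (P : Matrix (Fin ((2 ^ s) ^ 2)) (Fin ((2 ^ s) ^ 2)) ℂ) (hP : IsPermMatrix P) :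
    let 𝒜 := Afull s Q1 l j r P
    let Abar := Abarfull s Q1 l j r P
    let Ac := Abar - 𝒜
    let U := Matrix.fromBlocks Ac 𝒜 𝒜 Ac
    let U₁ := Matrix.fromBlocks (1 - 𝒜 * 𝒜ᵀ) (𝒜 * 𝒜ᵀ) (𝒜 * 𝒜ᵀ) (1 - 𝒜 * 𝒜ᵀ)
    let U₂ := Matrix.fromBlocks Abar 0 0 Abar
    U = U₁ * U₂ ∧ (U₁ * U₁ᴴ = 1 ∧ U₁ᴴ * U₁ = 1) ∧ (U₂ * U₂ᴴ = 1 ∧ U₂ᴴ * U₂ = 1) := by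
  intro 𝒜 Abar Ac U U₁ U₂
  have h : IsProjectionOf 𝒜 Abar := .Afull_Abarfull s Q1 l j r hP
  obtain ⟨hE, hEB⟩ := h.mul_transpose
  have hU₁ : U₁ * U₁ᴴ = 1 := hE.fromBlocks_mul_conjTranspose
  have hU₂ : U₂ * U₂ᴴ = 1 := by
    simp [U₂, fromBlocks_conjTranspose, fromBlocks_multiply, h.1.mul_conjTranspose]
  refine ⟨?_, ⟨hU₁, mul_eq_one_comm.mp hU₁⟩, ⟨hU₂, mul_eq_one_comm.mp hU₂⟩⟩
  simp [U, U₁, U₂, Ac, fromBlocks_multiply, sub_mul, hEB]
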